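/- Let F be a field, let n ≥ 3, and let g ∈ SL_n(F) be a non-central element. Then the elementary matrix e_{2,1} is a product of 8 elements of gcl_{SL_n(F)}(g); that is, e_{2,1} ∈ gcl_{SL_n(F)}(g)^8. -/

import Mathlib

open scoped Pointwise

/-- The elementary matrix `e_{i,j}(a) ∈ SL_n(F)`. -/
def elemSL {n : ℕ} {F : Type*} [CommRing F] (i j : Fin n) (hij : i ≠ j) (a : F) :
    Matrix.SpecialLinearGroup (Fin n) F :=
  ⟨Matrix.transvection i j a, Matrix.det_transvection_of_ne i j hij a⟩

/-- `gcl_Γ(α) = {βαβ⁻¹, βα⁻¹β⁻¹, 1 : β ∈ Γ}`. -/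
def gcl {Γ : Type*} [Group Γ] (α : Γ) : Set Γ :=
  {g | g = 1 ∨ ∃ β : Γ, g = β * α * β⁻¹ ∨ g = β * α⁻¹ * β⁻¹}

section Gcl

variable {Γ : Type*} [Group Γ] {α x : Γ}

theorem one_mem_gcl : (1 : Γ) ∈ gcl α := Or.inl rfl

theorem self_mem_gcl : α ∈ gcl α := Or.inr ⟨1, by simp⟩

theorem conj_mem_gcl_pow {k : ℕ} (hx : x ∈ gcl α ^ k) (β : Γ) : β * x * β⁻¹ ∈ gcl α ^ k := by
  have h : MulAut.conj β '' gcl α ⊆ gcl α := by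
    rintro _ ⟨y, rfl | ⟨γ, rfl | rfl⟩, rfl⟩
    · simp [one_mem_gcl]
    · exact Or.inr ⟨β * γ, Or.inl (by simp [mul_assoc])⟩
    · exact Or.inr ⟨β * γ, Or.inr (by simp [mul_assoc])⟩
  have h' := Set.pow_subset_pow_left (n := k) h
  rw [← Set.image_pow] at h'
  exact h' ⟨x, hx, by simp⟩

theorem inv_mem_gcl_pow {k : ℕ} (hx : x ∈ gcl α ^ k) : x⁻¹ ∈ gcl α ^ k := by
  have h : (gcl α)⁻¹ ⊆ gcl α := by
    rintro y (hy | ⟨γ, hy | hy⟩)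
    · rw [inv_eq_one.1 hy]; exact one_mem_gcl
    · exact Or.inr ⟨γ, Or.inr (by rw [← inv_inv y, hy]; simp [mul_assoc])⟩
    · exact Or.inr ⟨γ, Or.inl (by rw [← inv_inv y, hy]; simp [mul_assoc])⟩
  have h' := Set.pow_subset_pow_left (n := k) h
  rw [inv_pow] at h'
  exact h' (Set.inv_mem_inv.2 hx)

theorem commutator_mem_gcl_pow {k : ℕ} (hx : x ∈ gcl α ^ k) (β : Γ) :
    β * x * β⁻¹ * x⁻¹ ∈ gcl α ^ (k + k) := by
  rw [pow_add]
  exact Set.mul_mem_mul (conj_mem_gcl_pow hx β) (inv_mem_gcl_pow hx)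

end Gcl

open Matrix

theorem Matrix.exists_ne_zero_dotProduct_eq_zero {ι F : Type*} [Fintype ι] [Field F]
    (hι : 2 < Fintype.card ι) (χ ψ : ι → F) :
    ∃ w : ι → F, w ≠ 0 ∧ χ ⬝ᵥ w = 0 ∧ ψ ⬝ᵥ w = 0 := by
  obtain ⟨w, hw, hw0⟩ := (Submodule.ne_bot_iff _).1
    (LinearMap.ker_ne_bot_of_finrank_lt (f := (Matrix.of ![χ, ψ]).mulVecLin) (by simpa using hι))
  rw [LinearMap.mem_ker, mulVecLin_apply] at hw
  exact ⟨w, hw0, congrFun hw 0, congrFun hw 1⟩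

namespace Matrix.SpecialLinearGroup

variable {ι F : Type*} [Fintype ι] [DecidableEq ι]

/-- The transvection `1 + w χ`, where `w` is a column vector and `χ` a row vector with `χ w = 0`. -/
def shear [CommRing F] (w χ : ι → F) (h : χ ⬝ᵥ w = 0) : SpecialLinearGroup ι F :=
  ⟨1 + vecMulVec w χ, by
    rw [vecMulVec_eq Unit, det_one_add_replicateCol_mul_replicateRow, h, add_zero]⟩

section CommRing

variable [CommRing F]

@[simp]
theorem coe_shear (w χ : ι → F) (h : χ ⬝ᵥ w = 0) :
    (shear w χ h : Matrix ι ι F) = 1 + vecMulVec w χ := rfl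

theorem shear_mulVec_of_dotProduct_eq_zero (w χ : ι → F) (h : χ ⬝ᵥ w = 0) {x : ι → F}
    (hx : χ ⬝ᵥ x = 0) : (shear w χ h : Matrix ι ι F) *ᵥ x = x := by
  simp [add_mulVec, vecMulVec_mulVec, hx]

theorem shear_mul_shear (w χ ψ : ι → F) (hχ : χ ⬝ᵥ w = 0) (hψ : ψ ⬝ᵥ w = 0) :
    shear w χ hχ * shear w ψ hψ = shear w (χ + ψ) (by rw [add_dotProduct, hχ, hψ, add_zero]) := by
  ext1
  simp only [SpecialLinearGroup.coe_mul, coe_shear]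
  rw [mul_add, add_mul, add_mul, vecMulVec_mul_vecMulVec, hχ, vecMulVec_add]
  simp [add_assoc]

theorem inv_shear (w χ : ι → F) (h : χ ⬝ᵥ w = 0) :
    (shear w χ h)⁻¹ = shear w (-χ) (by rw [neg_dotProduct, h, neg_zero]) := by
  rw [inv_eq_iff_mul_eq_one, shear_mul_shear]
  ext1
  simp

theorem mul_shear_mul_inv (P : SpecialLinearGroup ι F) (w χ : ι → F) (h : χ ⬝ᵥ w = 0) :
    P * shear w χ h * P⁻¹ = shear ((P : Matrix ι ι F) *ᵥ w)
      (χ ᵥ* ((P⁻¹ : SpecialLinearGroup ι F) : Matrix ι ι F)) (by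
        rw [← dotProduct_mulVec, mulVec_mulVec, ← SpecialLinearGroup.coe_mul]
        simpa using h) := by
  ext1
  have hP : (P : Matrix ι ι F) * ((P⁻¹ : SpecialLinearGroup ι F) : Matrix ι ι F) = 1 := by
    rw [← SpecialLinearGroup.coe_mul, mul_inv_cancel, SpecialLinearGroup.coe_one]
  simp only [SpecialLinearGroup.coe_mul, coe_shear]
  rw [mul_add, add_mul, mul_one, hP, mul_vecMulVec, vecMulVec_mul]

theorem exists_shear_not_commute {g : SpecialLinearGroup ι F} (hg : g ∉ Subgroup.center _) :
    ∃ (w χ : ι → F) (h : χ ⬝ᵥ w = 0), ¬ Commute (shear w χ h) g := by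
  by_contra! H
  refine hg (Subgroup.mem_center_iff.2 fun A ↦ ?_)
  obtain ⟨r, hr⟩ := mem_range_scalar_of_commute_single (M := (g : Matrix ι ι F))
    fun i j hij ↦ by
      have := congrArg Subtype.val
        (H (Pi.single i 1) (Pi.single j 1) (by simp [hij.symm])).eq
      rw [SpecialLinearGroup.coe_mul, SpecialLinearGroup.coe_mul, coe_shear, add_mul, mul_add,
        one_mul, mul_one, add_right_inj, ← single_eq_single_vecMulVec_single] at this
      exact this
  refine Subtype.ext ?_
  rw [SpecialLinearGroup.coe_mul, SpecialLinearGroup.coe_mul, ← hr]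
  exact (scalar_commute r (fun _ ↦ mul_comm _ _) _).eq.symm

end CommRing

variable [Field F]

theorem exists_mulVec_single_eq_vecMul_eq_single {i j k : ι} (hij : i ≠ j) (hik : i ≠ k)
    (hjk : j ≠ k) {w χ : ι → F} (hw : w ≠ 0) (hχ : χ ≠ 0) (h : χ ⬝ᵥ w = 0) :
    ∃ P : SpecialLinearGroup ι F, (P : Matrix ι ι F) *ᵥ Pi.single j 1 = w ∧
      χ ᵥ* (P : Matrix ι ι F) = Pi.single i 1 := by
  obtain ⟨l, hl⟩ := Function.ne_iff.1 hχ
  simp only [Pi.zero_apply] at hl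
  set u : ι → F := Pi.single l (χ l)⁻¹ with hu
  have hχu : χ ⬝ᵥ u = 1 := by simp [hu, hl]
  have hu0 : u ≠ 0 := by rintro h0; simp [h0] at hχu
  have hi0 : (Pi.single i 1 : ι → F) ≠ 0 := by simp
  have hj0 : (Pi.single j 1 : ι → F) ≠ 0 := by simp
  obtain ⟨Q, hQu, hQw⟩ := (MulAction.is_two_pretransitive_iff.1
    (inferInstance : MulAction.IsMultiplyPretransitive (SpecialLinearGroup ι F)
      (Projectivization F (ι → F)) 2)) (show Projectivization.mk F _ hi0 ≠ .mk F _ hj0 by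
      rw [Ne, Projectivization.mk_eq_mk_iff']
      rintro ⟨a, ha⟩
      simpa [hij] using congrFun ha i)
    (show Projectivization.mk F u hu0 ≠ .mk F w hw by
      rw [Ne, Projectivization.mk_eq_mk_iff']
      rintro ⟨a, ha⟩
      simp [← ha, h] at hχu)
  rw [Projectivization.smul_mk, Projectivization.mk_eq_mk_iff] at hQu hQw
  obtain ⟨a, ha⟩ := hQu
  obtain ⟨b, hb⟩ := hQw
  replace ha : (Q : Matrix ι ι F) *ᵥ Pi.single i 1 = (a : F) • u := ha.symm
  replace hb : (Q : Matrix ι ι F) *ᵥ Pi.single j 1 = (b : F) • w := hb.symm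
  have hs (x : ι) (c : F) : (Pi.single x c : ι → F) = c • Pi.single x 1 := by
    simp [← Pi.single_smul']
  let D : SpecialLinearGroup ι F := ⟨diagonal fun x ↦ (if x = i then (a : F)⁻¹ else 1) *
    (if x = j then (b : F)⁻¹ else 1) * (if x = k then (a : F) * b else 1), by
      simp only [det_diagonal, Finset.prod_mul_distrib, Finset.prod_ite_eq', Finset.mem_univ,
        if_true]
      field_simp⟩
  have hDi : (Q * D : Matrix ι ι F) *ᵥ Pi.single i 1 = u := by
    rw [← mulVec_mulVec]
    simp only [D, diagonal_mulVec_single, hij, hik, if_true, if_false]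
    rw [hs, mulVec_smul, ha]
    simp [smul_smul]
  have hDj : (Q * D : Matrix ι ι F) *ᵥ Pi.single j 1 = w := by
    rw [← mulVec_mulVec]
    simp only [D, diagonal_mulVec_single, hij.symm, hjk, if_true, if_false]
    rw [hs, mulVec_smul, hb]
    simp [smul_smul]
  set r : ι → F := χ ᵥ* (Q * D : Matrix ι ι F) with hr
  have hri : r ⬝ᵥ Pi.single i 1 = 1 := by rw [hr, ← dotProduct_mulVec, hDi, hχu]
  have hrj : r ⬝ᵥ Pi.single j 1 = 0 := by rw [hr, ← dotProduct_mulVec, hDj, h]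
  refine ⟨Q * D * shear (Pi.single i 1) (Pi.single i 1 - r) ?_, ?_, ?_⟩
  · rw [sub_dotProduct, hri]; simp
  · rw [SpecialLinearGroup.coe_mul, SpecialLinearGroup.coe_mul, ← mulVec_mulVec,
      shear_mulVec_of_dotProduct_eq_zero, hDj]
    rw [sub_dotProduct, hrj]; simp [hij]
  · rw [SpecialLinearGroup.coe_mul, SpecialLinearGroup.coe_mul, ← vecMul_vecMul, ← hr, coe_shear,
      vecMul_add, vecMul_one, vecMul_vecMulVec, hri]
    simp

/-- All nontrivial transvections are conjugate in `SL_n`, `n ≥ 3`. -/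
theorem exists_conj_shear_eq_shear_single {i j k : ι} (hij : i ≠ j) (hik : i ≠ k)
    (hjk : j ≠ k) {w χ : ι → F} (hw : w ≠ 0) (hχ : χ ≠ 0) (h : χ ⬝ᵥ w = 0) :
    ∃ P : SpecialLinearGroup ι F,
      P * shear w χ h * P⁻¹ = shear (Pi.single j 1) (Pi.single i 1) (by simp [hij]) := by
  obtain ⟨P, rfl, hP⟩ := exists_mulVec_single_eq_vecMul_eq_single hij hik hjk hw hχ h
  refine ⟨P⁻¹, ?_⟩
  rw [mul_shear_mul_inv]
  refine Subtype.ext ?_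
  simp only [coe_shear, inv_inv, hP, mulVec_mulVec]
  rw [← SpecialLinearGroup.coe_mul, inv_mul_cancel, SpecialLinearGroup.coe_one, one_mulVec]

theorem eq_shear_of_forall_vecMul_eq {h : SpecialLinearGroup ι F} {w : ι → F} (hw : w ≠ 0)
    (hhw : (h : Matrix ι ι F) *ᵥ w = w)
    (H : ∀ ψ : ι → F, ψ ⬝ᵥ w = 0 → ψ ᵥ* (h : Matrix ι ι F) = ψ) :
    ∃ (χ : ι → F) (hχ : χ ⬝ᵥ w = 0), h = shear w χ hχ := by
  obtain ⟨k, hk⟩ := Function.ne_iff.1 hw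
  simp only [Pi.zero_apply] at hk
  set χ : ι → F := (w k)⁻¹ • ((h : Matrix ι ι F) k - Pi.single k 1) with hχ
  refine ⟨χ, ?_, ?_⟩
  · have := congrFun hhw k
    rw [mulVec] at this
    rw [hχ, smul_dotProduct, sub_dotProduct, this]
    simp
  · ext x y
    have := congrFun (H (Pi.single x (w k) - Pi.single k (w x)) (by
      simp [sub_dotProduct, mul_comm])) y
    simp only [sub_vecMul, single_vecMul, Pi.sub_apply, Pi.smul_apply, row_apply,
      smul_eq_mul] at this
    simp only [coe_shear, Matrix.add_apply, vecMulVec_apply, hχ, Pi.smul_apply, Pi.sub_apply,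
      smul_eq_mul, Matrix.one_apply]
    field_simp
    simp only [Pi.single_apply, eq_comm (a := y)] at this ⊢
    split_ifs at this ⊢ <;> linear_combination this

theorem exists_shear_mem_gcl_pow_four (hι : 2 < Fintype.card ι)
    {g : SpecialLinearGroup ι F} (hg : g ∉ Subgroup.center _) :
    ∃ (w χ : ι → F) (h : χ ⬝ᵥ w = 0), w ≠ 0 ∧ χ ≠ 0 ∧ shear w χ h ∈ gcl g ^ 4 := by
  obtain ⟨v, φ, hφ, hcomm⟩ := exists_shear_not_commute hg
  set t := shear v φ hφ with ht
  obtain ⟨h, hh⟩ : ∃ h, h = t * g * t⁻¹ * g⁻¹ := ⟨_, rfl⟩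
  have hmem : h ∈ gcl g ^ 2 := by
    rw [hh]
    exact commutator_mem_gcl_pow (k := 1) (by rw [pow_one]; exact self_mem_gcl) t
  have hne : h ≠ 1 := by
    rw [hh, Ne, mul_inv_eq_one, mul_inv_eq_iff_eq_mul]
    exact hcomm
  obtain ⟨w, hw, hφw, hφw'⟩ := exists_ne_zero_dotProduct_eq_zero hι φ
    (φ ᵥ* ((g⁻¹ : SpecialLinearGroup ι F) : Matrix ι ι F))
  have hhw : (h : Matrix ι ι F) *ᵥ w = w := by
    rw [← dotProduct_mulVec] at hφw'
    have hgw : (g : Matrix ι ι F) *ᵥ ((g⁻¹ : SpecialLinearGroup ι F) : Matrix ι ι F) *ᵥ w = w := by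
      rw [mulVec_mulVec, ← SpecialLinearGroup.coe_mul, mul_inv_cancel, SpecialLinearGroup.coe_one,
        one_mulVec]
    simp only [hh, SpecialLinearGroup.coe_mul, ← mulVec_mulVec]
    rw [ht, inv_shear, shear_mulVec_of_dotProduct_eq_zero _ (-φ) _
      (by rw [neg_dotProduct, hφw', neg_zero]), hgw,
      shear_mulVec_of_dotProduct_eq_zero _ _ _ hφw]
  by_cases H : ∀ ψ : ι → F, ψ ⬝ᵥ w = 0 → ψ ᵥ* (h : Matrix ι ι F) = ψ
  · obtain ⟨χ, hχ, rfl⟩ := eq_shear_of_forall_vecMul_eq hw hhw H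
    refine ⟨w, χ, hχ, hw, ?_, Set.pow_subset_pow_right one_mem_gcl (by norm_num) hmem⟩
    rintro rfl
    exact hne (by ext1; simp)
  · push Not at H
    obtain ⟨ψ, hψ, hψh⟩ := H
    have key := commutator_mem_gcl_pow hmem (shear w ψ hψ)
    rw [mul_assoc, mul_assoc, ← mul_assoc h, inv_shear, mul_shear_mul_inv] at key
    simp only [hhw] at key
    rw [shear_mul_shear] at key
    refine ⟨w, _, _, hw, fun h0 ↦ hψh ?_, key⟩
    rw [neg_vecMul, add_neg_eq_zero] at h0
    nth_rw 1 [h0]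
    rw [vecMul_vecMul, ← SpecialLinearGroup.coe_mul]
    simp

end Matrix.SpecialLinearGroup

open Matrix.SpecialLinearGroup in
/-- For a field `F`, `n ≥ 3`, and a non-central `g ∈ SL_n(F)`, the elementary matrix
`e_{2,1}` is a product of 8 elements of `gcl_{SL_n(F)}(g)`. -/
theorem elem_mem_gcl_pow_eight (F : Type*) [Field F] (n : ℕ) (hn : 3 ≤ n)
    (g : Matrix.SpecialLinearGroup (Fin n) F)
    (hg : g ∉ Subgroup.center (Matrix.SpecialLinearGroup (Fin n) F)) :
    elemSL (⟨1, by omega⟩ : Fin n) (⟨0, by omega⟩ : Fin n)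
        (by simp [Fin.ext_iff]) (1 : F) ∈ gcl g ^ (8 : ℕ) := by
  obtain ⟨w, χ, h, hw, hχ, hmem⟩ :=
    exists_shear_mem_gcl_pow_four (by simpa using Nat.lt_of_succ_le hn) hg
  obtain ⟨P, hP⟩ := exists_conj_shear_eq_shear_single
    (i := (⟨0, by omega⟩ : Fin n)) (j := ⟨1, by omega⟩) (k := ⟨2, by omega⟩)
    (by simp) (by simp) (by simp) hw hχ h
  have key := conj_mem_gcl_pow hmem P
  rw [hP] at key
  convert Set.pow_subset_pow_right one_mem_gcl (by norm_num : 4 ≤ 8) key using 1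
  refine Subtype.ext ?_
  rw [coe_shear, ← single_eq_single_vecMulVec_single]
  rfl
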